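/- Let p > 2 and ℓ > 0. Suppose u : [0,ℓ] → ℝ is twice continuously differentiable with u''(x) = u(x) − |u(x)|^(p−2) u(x) for all x ∈ [0,ℓ], and that 0 < u(0) < (p/2)^(1/(p−2)), u'(0) = −2·√(2 f(u(0))), and u'(ℓ) = 0. Then u changes sign on [0,ℓ]; in particular there exists x ∈ [0,ℓ] with u(x) < 0. -/

import Mathlib

/-- `f(t) = t²/2 - tᵖ/p`. -/
noncomputable def f (p t : ℝ) : ℝ := t ^ 2 / 2 - t ^ p / p

theorem rpow_sub_two_mul_self {p t : ℝ} (hp : 2 < p) (ht : 0 ≤ t) :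
    t ^ (p - 2) * t = t ^ (p - 1) := by
  rw [← Real.rpow_add_one' ht (by linarith)]
  congr 1
  ring

theorem f_eq_sq_mul {p t : ℝ} (hp : 2 < p) (ht : 0 ≤ t) :
    f p t = t ^ 2 * (1 / 2 - t ^ (p - 2) / p) := by
  have h : t ^ p = t ^ (p - 2) * t ^ 2 := by
    rw [← Real.rpow_natCast, ← Real.rpow_add' ht (by push_cast; linarith)]
    congr 1
    push_cast
    ring
  rw [f, h]
  ring

theorem rpow_sub_two_div_lt_half {p t : ℝ} (hp : 2 < p) (ht : 0 ≤ t)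
    (hlt : t < (p / 2) ^ (1 / (p - 2))) : t ^ (p - 2) / p < 1 / 2 := by
  have hlt' : t ^ (p - 2) < p / 2 := by
    rw [one_div] at hlt
    exact (Real.lt_rpow_inv_iff_of_pos ht (by linarith) (by linarith)).1 hlt
  rw [div_lt_iff₀ (by linarith)]
  linarith

theorem f_nonneg {p t : ℝ} (hp : 2 < p) (ht : 0 ≤ t)
    (hlt : t < (p / 2) ^ (1 / (p - 2))) : 0 ≤ f p t := by
  rw [f_eq_sq_mul hp ht]
  have := rpow_sub_two_div_lt_half hp ht hlt
  exact mul_nonneg (sq_nonneg t) (by linarith)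

theorem f_pos {p t : ℝ} (hp : 2 < p) (ht : 0 < t)
    (hlt : t < (p / 2) ^ (1 / (p - 2))) : 0 < f p t := by
  rw [f_eq_sq_mul hp ht.le]
  have := rpow_sub_two_div_lt_half hp ht.le hlt
  exact mul_pos (by positivity) (by linarith)

/-- The energy `u'² / 2 - f(u)` is stationary where `u'' = u - |u|^(p-2) u` and `u ≥ 0`. -/
theorem hasDerivAt_energy {p : ℝ} (hp : 2 < p) {u u' : ℝ → ℝ} {x : ℝ}
    (hu : HasDerivAt u (u' x) x)
    (hu' : HasDerivAt u' (u x - |u x| ^ (p - 2) * u x) x) (hx : 0 ≤ u x) :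
    HasDerivAt (fun y => u' y ^ 2 / 2 - f p (u y)) 0 x := by
  have hpow := (hu.rpow_const (p := p) (Or.inr (by linarith))).div_const p
  have h := ((hu'.pow 2).div_const 2).sub (((hu.pow 2).div_const 2).sub hpow)
  refine h.congr_deriv ?_
  rw [abs_of_nonneg hx, rpow_sub_two_mul_self hp hx]
  have : p ≠ 0 := by linarith
  field_simp
  push_cast
  ring

theorem IsMinOn.deriv_nonneg_of_left_endpoint {u : ℝ → ℝ} {a b d : ℝ} (hab : a < b)
    (hmin : IsMinOn u (Set.Icc a b) a) (hu : HasDerivAt u d a) : 0 ≤ d := by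
  have hcone : b - a ∈ posTangentConeAt (Set.Icc a b) a :=
    sub_mem_posTangentConeAt_of_segment_subset (segment_eq_Icc hab.le).subset
  have h := hmin.localize.hasFDerivWithinAt_nonneg hu.hasFDerivAt.hasFDerivWithinAt hcone
  simp only [ContinuousLinearMap.toSpanSingleton_apply, smul_eq_mul] at h
  exact nonneg_of_mul_nonneg_right h (sub_pos.2 hab)

/-- let `p > 2`, `ℓ > 0`, and let `u` be twice continuously differentiable on
`[0,ℓ]` with `u'' = u - |u|^(p-2) u`, `0 < u(0) < (p/2)^(1/(p-2))`,
`u'(0) = -2 √(2 f(u(0)))` and `u'(ℓ) = 0`. Then `u` takes a negative value on `[0,ℓ]`. -/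
theorem stmt_8 (p : ℝ) (hp : 2 < p) (ℓ : ℝ) (hℓ : 0 < ℓ)
    (u u' : ℝ → ℝ)
    (hu : ∀ x ∈ Set.Icc (0 : ℝ) ℓ, HasDerivAt u (u' x) x)
    (hu' : ∀ x ∈ Set.Icc (0 : ℝ) ℓ, HasDerivAt u' (u x - |u x| ^ (p - 2) * u x) x)
    (h0 : 0 < u 0) (h1 : u 0 < (p / 2) ^ (1 / (p - 2)))
    (hd0 : u' 0 = -2 * Real.sqrt (2 * f p (u 0)))
    (hdl : u' ℓ = 0) :
    ∃ x ∈ Set.Icc (0 : ℝ) ℓ, u x < 0 := by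
  by_contra! hnonneg
  have hf0 : 0 < f p (u 0) := f_pos hp h0 h1
  have hzero : (0 : ℝ) ∈ Set.Icc 0 ℓ := ⟨le_rfl, hℓ.le⟩
  obtain ⟨m, hm, hmin⟩ := isCompact_Icc.exists_isMinOn ⟨0, hzero⟩
    (fun x hx => (hu x hx).continuousAt.continuousWithinAt : ContinuousOn u (Set.Icc 0 ℓ))
  have hd0_neg : u' 0 < 0 := by
    have := Real.sqrt_pos.2 (by linarith : 0 < 2 * f p (u 0))
    linarith
  have hdm : u' m = 0 := by
    rcases hm.1.eq_or_lt with rfl | hm0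
    · exact absurd (hmin.deriv_nonneg_of_left_endpoint hℓ (hu 0 hzero)) hd0_neg.not_ge
    rcases hm.2.eq_or_lt with rfl | hmℓ
    · exact hdl
    · exact (hmin.isLocalMin (Icc_mem_nhds hm0 hmℓ)).hasDerivAt_eq_zero (hu m hm)
  have hE := fun x (hx : x ∈ Set.Icc 0 ℓ) =>
    hasDerivAt_energy hp (hu x hx) (hu' x hx) (hnonneg x hx)
  have hconst : u' m ^ 2 / 2 - f p (u m) = u' 0 ^ 2 / 2 - f p (u 0) :=
    constant_of_has_deriv_right_zero
      (fun x hx => (hE x hx).continuousAt.continuousWithinAt)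
      (fun x hx => (hE x (Set.Ico_subset_Icc_self hx)).hasDerivWithinAt) m hm
  have hfm : 0 ≤ f p (u m) := f_nonneg hp (hnonneg m hm) ((hmin hzero).trans_lt h1)
  rw [hdm, hd0, mul_pow, Real.sq_sqrt (by linarith)] at hconst
  linarith
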